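/- arXiv:1203.3851 — 2 statements merged into one kernel-verified Lean document; each statement's English description precedes it below -/
import Mathlib

section
/- Let C be a finite subgroup of Γ_A with C ∩ ker π = {1}, let a be a generator of A, let O ⊆ A be the orbit of a under C̄ = π(C), and set χ = Σ_{σ ∈ C} σ • δ_a ∈ Maps(A,K). Then χ is fixed by every element of C, χ vanishes at every point of A outside O, and χ(b) ≠ 0 for every b ∈ O. (These are the assertions 3.2.19–3.2.20 in the proof of Lemma 3.2 of the paper.) -/
open scoped Classical

variable (K : Type*) [Field K] (A : Type*) [Group A]

/-- The action of `Aut(A)` on the character group `A →* Kˣ` by `α • ψ = ψ ∘ α⁻¹`. -/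
noncomputable def charAut : MulAut A →* MulAut (A →* Kˣ) where
  toFun α :=
    { toFun := fun ψ => ψ.comp α.symm.toMonoidHom
      invFun := fun ψ => ψ.comp α.toMonoidHom
      left_inv := fun ψ => by ext a; simp
      right_inv := fun ψ => by ext a; simp
      map_mul' := fun ψ φ => by ext a; simp }
  map_one' := by ext ψ a; simp [MulAut.one_def]
  map_mul' := fun α β => by ext ψ a; simp [MulAut.mul_def, MulEquiv.symm_trans_apply]

/-- The group `Γ_A = (A →* Kˣ) ⋊ Aut(A)`. -/
noncomputable abbrev Gam := (A →* Kˣ) ⋊[charAut K A] (MulAut A)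

/-- The `K`-linear action of `Γ_A` on `Maps(A, K)`:
`((ψ, α) • f) a = ψ a * f (α⁻¹ a)`. -/
noncomputable def act (σ : Gam K A) : (A → K) →ₗ[K] (A → K) where
  toFun f a := (σ.left a : K) * f (σ.right.symm a)
  map_add' f g := by funext a; simp [mul_add]
  map_smul' c f := by funext a; simp only [Pi.smul_apply, smul_eq_mul, RingHom.id_apply]; ring

/-- The fixed subspace of `Maps(A, K)` under a set of elements of `Γ_A`. -/
noncomputable def fixedSpace (S : Set (Gam K A)) : Submodule K (A → K) where
  carrier := {f | ∀ σ ∈ S, act K A σ f = f}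
  add_mem' := by intro f g hf hg σ hσ; rw [map_add, hf σ hσ, hg σ hσ]
  zero_mem' := by intro σ hσ; exact map_zero _
  smul_mem' := by intro c f hf σ hσ; rw [map_smul, hf σ hσ]

/-- The indicator function `δ_a` of a point `a`. -/
noncomputable def delta (a : A) : A → K := fun b => if b = a then 1 else 0

theorem act_mul (σ τ : Gam K A) (f : A → K) :
    act K A (σ * τ) f = act K A σ (act K A τ f) := by
  funext b
  simp [act, charAut, MulAut.mul_def, MulEquiv.symm_trans_apply, mul_assoc]

theorem act_delta_apply (σ : Gam K A) (a b : A) :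
    act K A σ (delta K A a) b = if σ.right a = b then (σ.left b : K) else 0 := by
  simp [act, delta, MulEquiv.symm_apply_eq, eq_comm (a := b)]

/-- An automorphism of `A` is determined by its value at a generator of `A`. -/
theorem mulAut_ext_of_zpowers_eq_top {a : A} (ha : Subgroup.zpowers a = ⊤)
    {α β : MulAut A} (h : α a = β a) : α = β := by
  ext b
  obtain ⟨n, rfl⟩ := Subgroup.mem_zpowers_iff.mp (ha ▸ Subgroup.mem_top b)
  rw [map_zpow, map_zpow, h]

/-- `π` is injective on a subgroup meeting its kernel trivially. -/
theorem eq_of_right_eq {C : Subgroup (Gam K A)}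
    (htriv : C ⊓ MonoidHom.ker (SemidirectProduct.rightHom : Gam K A →* MulAut A) = ⊥)
    {σ τ : Gam K A} (hσ : σ ∈ C) (hτ : τ ∈ C) (h : σ.right = τ.right) : σ = τ := by
  have hmem : σ * τ⁻¹ ∈
      C ⊓ MonoidHom.ker (SemidirectProduct.rightHom : Gam K A →* MulAut A) :=
    ⟨C.mul_mem hσ (C.inv_mem hτ), by simp [h]⟩
  rw [htriv, Subgroup.mem_bot] at hmem
  exact mul_inv_eq_one.mp hmem

/-- **3.2.19–3.2.20 in the proof of Lemma 3.2.** For a finite subgroup `C ≤ Γ_A` meeting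
`ker π` trivially and a generator `a` of `A`, the element `χ = ∑_{σ ∈ C} σ • δ_a` is
fixed by every element of `C`, vanishes outside the orbit `O` of `a` under `π(C)`, and is
nonzero at every point of `O`. -/
theorem chi_fixed_supported_nonvanishing
    [IsAlgClosed K] [CharZero K] [Finite A] [IsCyclic A]
    (C : Subgroup (Gam K A)) [Fintype C]
    (htriv : C ⊓ MonoidHom.ker (SemidirectProduct.rightHom : Gam K A →* MulAut A) = ⊥)
    (a : A) (ha : Subgroup.zpowers a = ⊤)
    (O : Set A)
    (hO : O = {b | ∃ τ ∈ C.map (SemidirectProduct.rightHom : Gam K A →* MulAut A),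
                τ a = b})
    (χ : A → K) (hχ : χ = ∑ σ : C, act K A (σ : Gam K A) (delta K A a)) :
    (∀ τ ∈ C, act K A τ χ = χ) ∧ (∀ b ∉ O, χ b = 0) ∧ (∀ b ∈ O, χ b ≠ 0) := by
  subst hO hχ
  refine ⟨fun τ hτ => ?_, fun b hb => ?_, ?_⟩
  · rw [map_sum]
    simp_rw [← act_mul]
    exact Fintype.sum_equiv (Equiv.mulLeft (⟨τ, hτ⟩ : C)) _ _ fun σ => rfl
  · rw [Finset.sum_apply]
    refine Finset.sum_eq_zero fun σ _ => ?_
    rw [act_delta_apply, if_neg]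
    exact fun h => hb ⟨σ.1.right, ⟨σ.1, σ.2, rfl⟩, h⟩
  · rintro b ⟨_, ⟨τ, hτ, rfl⟩, rfl⟩
    rw [Finset.sum_apply, Finset.sum_eq_single (⟨τ, hτ⟩ : C)]
    · rw [act_delta_apply, if_pos (by rfl)]
      exact Units.ne_zero _
    · intro σ _ hne
      rw [act_delta_apply, if_neg]
      exact fun h => hne (Subtype.ext (eq_of_right_eq K A htriv σ.2 hτ
        (mulAut_ext_of_zpowers_eq_top A ha h)))
    · exact fun h => absurd (Finset.mem_univ _) h
end

section
/- Let C be a finite subgroup of Γ_A with C ∩ ker π = {1}, let a be a generator of A, let O ⊆ A be the orbit of a under π(C), and set χ = Σ_{σ ∈ C} σ • δ_a ∈ Maps(A,K). Then for every τ ∈ C and every f ∈ Maps(A,K) vanishing outside O, one has τ • (χ · f) = χ · ((1, π(τ)) • f), where χ · f denotes the pointwise product of functions and (1, π(τ)) ∈ Γ_A is the element with trivial character component. In other words, after multiplication by χ the action of τ on functions supported on O becomes the untwisted permutation action of π(τ). (This is the conjugation identity 3.2.21 in the proof of Lemma 3.2 of the paper.) -/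
open scoped Classical

variable (K : Type*) [Field K] (A : Type*) [Group A]

/-- The sum of an orbit, taken over a finite subgroup, is invariant under that subgroup. -/
theorem act_sum_act_eq (C : Subgroup (Gam K A)) [Fintype C] (g : A → K)
    (τ : Gam K A) (hτ : τ ∈ C) :
    act K A τ (∑ σ : C, act K A (σ : Gam K A) g) = ∑ σ : C, act K A (σ : Gam K A) g := by
  rw [map_sum]
  exact Fintype.sum_equiv (Equiv.mulLeft (⟨τ, hτ⟩ : C)) _ _ fun σ => by simp [act_mul]

/-- **The conjugation identity 3.2.21 in the proof of Lemma 3.2.** With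
`χ = ∑_{σ ∈ C} σ • δ_a`, multiplication by `χ` intertwines the action of `τ ∈ C` on
functions supported on the orbit `O` with the untwisted permutation action of `π(τ)`:
`τ • (χ · f) = χ · ((1, π(τ)) • f)`. -/
theorem act_mul_chi_eq_chi_mul_untwisted
    [IsAlgClosed K] [CharZero K] [Finite A] [IsCyclic A]
    (C : Subgroup (Gam K A)) [Fintype C]
    (htriv : C ⊓ MonoidHom.ker (SemidirectProduct.rightHom : Gam K A →* MulAut A) = ⊥)
    (a : A) (ha : Subgroup.zpowers a = ⊤)
    (O : Set A)
    (hO : O = {b | ∃ τ ∈ C.map (SemidirectProduct.rightHom : Gam K A →* MulAut A),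
                τ a = b})
    (χ : A → K) (hχ : χ = ∑ σ : C, act K A (σ : Gam K A) (delta K A a))
    (τ : Gam K A) (hτ : τ ∈ C)
    (f : A → K) (hf : ∀ b ∉ O, f b = 0) :
    act K A τ (χ * f)
      = χ * act K A
          (SemidirectProduct.inr (SemidirectProduct.rightHom τ) : Gam K A) f := by
  have hinv : act K A τ χ = χ := by
    rw [hχ]
    exact act_sum_act_eq K A C _ τ hτ
  funext b
  have hb := congrFun hinv b
  simp only [act, LinearMap.coe_mk, AddHom.coe_mk] at hb
  simp [act, ← mul_assoc, hb]
end
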